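/- If W is a closed linear subspace of L¹([0,1]; ℝ) such that the constant function 1_{[0,1]} belongs to W and γ(f, g) ∈ W whenever f, g ∈ W, then W = L¹([0,1]; ℝ). -/

import Mathlib

open MeasureTheory

/-- Lebesgue measure restricted to `[0,1]`. -/
noncomputable def unitMeasure : Measure ℝ := volume.restrict (Set.Icc (0:ℝ) 1)

/-- The juxtaposition `γ(f,g)(x) = f(2x)` for `x < 1/2`, `g(2x − 1)` for `x ≥ 1/2`. -/
noncomputable def gammaFun {E : Type*} (f g : ℝ → E) (x : ℝ) : E :=
  if x < 1/2 then f (2 * x) else g (2 * x - 1)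

open Filter Topology

instance : IsFiniteMeasure unitMeasure := by
  unfold unitMeasure; infer_instance

lemma quasiMeasurePreserving_two_mul :
    Measure.QuasiMeasurePreserving (fun x : ℝ => 2 * x) volume volume := by
  refine ⟨measurable_const_mul 2, ?_⟩
  rw [Real.map_volume_mul_left two_ne_zero]
  exact Measure.smul_absolutelyContinuous

lemma gammaFun_congr_ae {E : Type*} {f f' g g' : ℝ → E}
    (hf : f =ᵐ[unitMeasure] f') (hg : g =ᵐ[unitMeasure] g') :
    gammaFun f g =ᵐ[unitMeasure] gammaFun f' g' := by
  have hq : Measure.QuasiMeasurePreserving (fun x : ℝ => 2 * x - 1) volume volume :=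
    (measurePreserving_sub_right volume (1 : ℝ)).quasiMeasurePreserving.comp
      quasiMeasurePreserving_two_mul
  unfold unitMeasure at *
  rw [EventuallyEq, ae_restrict_iff' measurableSet_Icc] at *
  filter_upwards [quasiMeasurePreserving_two_mul.ae hf, hq.ae hg] with x hx hx' ⟨h0, h1⟩
  unfold gammaFun
  split_ifs with h
  · exact hx ⟨by linarith, by linarith⟩
  · exact hx' ⟨by linarith, by linarith⟩

/-- The dyadic step function of level `n` sampling `f` at the left endpoint of each interval. -/
noncomputable def dyadicStep (n : ℕ) (f : ℝ → ℝ) (x : ℝ) : ℝ :=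
  f (⌊2 ^ n * x⌋ / 2 ^ n)

lemma dyadicStep_succ (n : ℕ) (f : ℝ → ℝ) :
    dyadicStep (n + 1) f =
      gammaFun (dyadicStep n fun x => f (x / 2)) (dyadicStep n fun x => f ((x + 1) / 2)) := by
  funext x
  have hl : (2 : ℝ) ^ (n + 1) * x = 2 ^ n * (2 * x) := by ring
  have hr : (2 : ℝ) ^ n * (2 * x - 1) = 2 ^ (n + 1) * x - ((2 ^ n : ℤ) : ℝ) := by
    push_cast; ring
  unfold gammaFun dyadicStep
  split_ifs
  · rw [hl]
    congr 1
    field_simp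
    ring
  · rw [hr, Int.floor_sub_intCast]
    congr 1
    push_cast
    field_simp
    ring

lemma measurable_dyadicStep (n : ℕ) {f : ℝ → ℝ} (hf : Measurable f) :
    Measurable (dyadicStep n f) :=
  hf.comp (((measurable_from_top (f := ((↑) : ℤ → ℝ))).comp
    (Int.measurable_floor.comp (measurable_const_mul _))).div_const _)

lemma memLp_dyadicStep (n : ℕ) {f : ℝ → ℝ} (hf : Measurable f) {C : ℝ} (hC : ∀ x, ‖f x‖ ≤ C) :
    MemLp (dyadicStep n f) 1 unitMeasure :=
  MemLp.of_bound (measurable_dyadicStep n hf).aestronglyMeasurable C (ae_of_all _ fun _ => hC _)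

lemma tendsto_floor_two_pow_mul_div (x : ℝ) :
    Tendsto (fun n : ℕ => (⌊2 ^ n * x⌋ / 2 ^ n : ℝ)) atTop (𝓝 x) := by
  have hlim : Tendsto (fun n : ℕ => x - (1 / 2 : ℝ) ^ n) atTop (𝓝 x) := by
    simpa using tendsto_const_nhds.sub
      (tendsto_pow_atTop_nhds_zero_of_lt_one (r := (1 / 2 : ℝ)) (by norm_num) (by norm_num))
  refine tendsto_of_tendsto_of_tendsto_of_le_of_le hlim tendsto_const_nhds
    (fun n => ?_) (fun n => ?_)
  · have h : x - (1 / 2 : ℝ) ^ n = (2 ^ n * x - 1) / 2 ^ n := by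
      rw [one_div, inv_pow]; field_simp
    simp only [h]
    gcongr
    exact (Int.sub_one_lt_floor _).le
  · simp only
    rw [div_le_iff₀ (by positivity), mul_comm x]
    exact Int.floor_le _

lemma dyadicStep_zero_ae (f : ℝ → ℝ) : dyadicStep 0 f =ᵐ[unitMeasure] fun _ => f 0 := by
  unfold unitMeasure
  rw [← restrict_Ico_eq_restrict_Icc]
  filter_upwards [ae_restrict_mem measurableSet_Ico] with x hx
  have : ⌊x⌋ = 0 := Int.floor_eq_zero_iff.2 hx
  simp [dyadicStep, this]

lemma toLp_dyadicStep_mem {W : Submodule ℝ (Lp ℝ 1 unitMeasure)}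
    (hone : ∀ one : Lp ℝ 1 unitMeasure,
      ⇑one =ᵐ[unitMeasure] (fun _ => (1 : ℝ)) → one ∈ W)
    (hgamma : ∀ f g h : Lp ℝ 1 unitMeasure, f ∈ W → g ∈ W →
      ⇑h =ᵐ[unitMeasure] gammaFun ⇑f ⇑g → h ∈ W)
    (n : ℕ) {f : ℝ → ℝ} (hf : Measurable f) {C : ℝ} (hC : ∀ x, ‖f x‖ ≤ C) :
    (memLp_dyadicStep n hf hC).toLp ∈ W := by
  induction n generalizing f with
  | zero =>
    have h1 : MemLp (fun _ : ℝ => (1 : ℝ)) 1 unitMeasure := memLp_const 1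
    have : (memLp_dyadicStep 0 hf hC).toLp = f 0 • h1.toLp := by
      rw [← MemLp.toLp_const_smul, MemLp.toLp_eq_toLp_iff]
      filter_upwards [dyadicStep_zero_ae f] with x hx
      simpa using hx
    rw [this]
    exact W.smul_mem _ (hone _ h1.coeFn_toLp)
  | succ n ih =>
    have hl : Measurable fun x => f (x / 2) := by fun_prop
    have hr : Measurable fun x => f ((x + 1) / 2) := by fun_prop
    refine hgamma _ _ _ (ih hl fun x => hC _) (ih hr fun x => hC _) ?_
    refine (MemLp.coeFn_toLp _).trans ?_
    rw [dyadicStep_succ]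
    exact gammaFun_congr_ae (MemLp.coeFn_toLp _).symm (MemLp.coeFn_toLp _).symm

lemma tendsto_eLpNorm_dyadicStep_sub {f : ℝ → ℝ} (hf : Continuous f) {C : ℝ}
    (hC : ∀ x, ‖f x‖ ≤ C) :
    Tendsto (fun n => eLpNorm (dyadicStep n f - f) 1 unitMeasure) atTop (𝓝 0) := by
  have := tendsto_lintegral_norm_of_dominated_convergence (μ := unitMeasure)
    (F := fun n => dyadicStep n f) (f := f) (bound := fun _ => C)
    (fun n => (measurable_dyadicStep n hf.measurable).aestronglyMeasurable)
    (integrable_const C).hasFiniteIntegral (fun n => ae_of_all _ fun x => hC _)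
    (ae_of_all _ fun x => (hf.tendsto x).comp (tendsto_floor_two_pow_mul_div x))
  simpa only [eLpNorm_one_eq_lintegral_enorm, Pi.sub_apply, ofReal_norm] using this

/-- a closed linear subspace of `L¹([0,1];ℝ)` containing the constant
function `1` and closed under the juxtaposition `γ` is all of `L¹([0,1];ℝ)`. -/
theorem closed_subspace_with_one_and_gamma_is_everything
    (W : Submodule ℝ (Lp ℝ 1 unitMeasure))
    (hclosed : IsClosed (W : Set (Lp ℝ 1 unitMeasure)))
    (hone : ∀ one : Lp ℝ 1 unitMeasure,
      ⇑one =ᵐ[unitMeasure] (fun _ => (1 : ℝ)) → one ∈ W)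
    (hgamma : ∀ f g h : Lp ℝ 1 unitMeasure, f ∈ W → g ∈ W →
      ⇑h =ᵐ[unitMeasure] gammaFun ⇑f ⇑g → h ∈ W) :
    W = ⊤ := by
  have : unitMeasure.WeaklyRegular := by unfold unitMeasure; infer_instance
  refine Submodule.eq_top_iff'.2 fun u => ?_
  refine (BoundedContinuousFunction.toLp_denseRange ℝ unitMeasure ℝ
    ENNReal.one_ne_top).induction_on (p := fun u => u ∈ W) u hclosed fun f => ?_
  have hC := f.norm_coe_le_norm
  have hmem : MemLp f 1 unitMeasure :=
    MemLp.of_bound f.continuous.aestronglyMeasurable ‖f‖ (ae_of_all _ hC)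
  have heq : BoundedContinuousFunction.toLp 1 unitMeasure ℝ f = hmem.toLp :=
    Lp.ext ((BoundedContinuousFunction.coeFn_toLp 1 unitMeasure ℝ f).trans
      hmem.coeFn_toLp.symm)
  rw [heq]
  exact hclosed.mem_of_tendsto
    ((Lp.tendsto_Lp_iff_tendsto_eLpNorm'' _
      (fun n => memLp_dyadicStep n f.continuous.measurable hC) _ hmem).2
      (tendsto_eLpNorm_dyadicStep_sub f.continuous hC))
    (Eventually.of_forall fun n =>
      toLp_dyadicStep_mem hone hgamma n f.continuous.measurable hC)
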